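/- For all six points x₁,…,x₆ ∈ ℂ³ the identity t₀u = t₁t₄(t₁ − t₂ − t₃ + t₄ − t₅) holds. -/

import Mathlib

/-- The bracket `[abc]`: determinant of the `3×3` matrix with rows `a, b, c`. -/
noncomputable def br (a b c : Fin 3 → ℂ) : ℂ := Matrix.det (Matrix.of ![a, b, c])

/-- `t₀ = [124][135][236]` (points indexed `0,…,5` for the paper's `1,…,6`). -/
noncomputable def t0 (x : Fin 6 → Fin 3 → ℂ) : ℂ :=
  br (x 0) (x 1) (x 3) * br (x 0) (x 2) (x 4) * br (x 1) (x 2) (x 5)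

/-- `t₁ = [123][135][246]` -/
noncomputable def t1 (x : Fin 6 → Fin 3 → ℂ) : ℂ :=
  br (x 0) (x 1) (x 2) * br (x 0) (x 2) (x 4) * br (x 1) (x 3) (x 5)

/-- `t₂ = [123][134][256]` -/
noncomputable def t2 (x : Fin 6 → Fin 3 → ℂ) : ℂ :=
  br (x 0) (x 1) (x 2) * br (x 0) (x 2) (x 3) * br (x 1) (x 4) (x 5)

/-- `t₃ = [123][125][346]` -/
noncomputable def t3 (x : Fin 6 → Fin 3 → ℂ) : ℂ :=
  br (x 0) (x 1) (x 2) * br (x 0) (x 1) (x 4) * br (x 2) (x 3) (x 5)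

/-- `t₄ = [123][124][356]` -/
noncomputable def t4 (x : Fin 6 → Fin 3 → ℂ) : ℂ :=
  br (x 0) (x 1) (x 2) * br (x 0) (x 1) (x 3) * br (x 2) (x 4) (x 5)

/-- `t₅ = [123][123][456]` -/
noncomputable def t5 (x : Fin 6 → Fin 3 → ℂ) : ℂ :=
  br (x 0) (x 1) (x 2) * br (x 0) (x 1) (x 2) * br (x 3) (x 4) (x 5)

/-- `u = [123][123][123][145][246][356]` -/
noncomputable def uInv (x : Fin 6 → Fin 3 → ℂ) : ℂ :=
  br (x 0) (x 1) (x 2) * br (x 0) (x 1) (x 2) * br (x 0) (x 1) (x 2) *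
    br (x 0) (x 3) (x 4) * br (x 1) (x 3) (x 5) * br (x 2) (x 4) (x 5)

/-- Straightening relation for the non-standard bracket product `[bcf][ade]`. -/
theorem br_mul_br_straighten (a b c d e f : Fin 3 → ℂ) :
    br b c f * br a d e = br a c e * br b d f - br a c d * br b e f - br a b e * br c d f
      + br a b d * br c e f - br a b c * br d e f := by
  simp only [br, Matrix.det_fin_three, Matrix.of_apply, Matrix.cons_val]
  ring

theorem stmt_14 (x : Fin 6 → Fin 3 → ℂ) :
    t0 x * uInv x = t1 x * t4 x * (t1 x - t2 x - t3 x + t4 x - t5 x) := by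
  simp only [t0, t1, t2, t3, t4, t5, uInv]
  linear_combination br (x 0) (x 1) (x 2) ^ 3 * br (x 0) (x 1) (x 3) * br (x 0) (x 2) (x 4) *
    br (x 1) (x 3) (x 5) * br (x 2) (x 4) (x 5) *
    br_mul_br_straighten (x 0) (x 1) (x 2) (x 3) (x 4) (x 5)
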